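/- arXiv:1812.11195 — 2 statements merged into one kernel-verified Lean document; each statement's English description precedes it below -/
import Mathlib

section
/- Every J-Noetherian Bezout ring is an elementary divisor ring. -/
/-- A commutative ring is `J`-Noetherian if it satisfies the ascending chain condition
on `J`-radical ideals, i.e. ideals that equal the intersection of all maximal ideals
containing them (equivalently, ideals fixed by `Ideal.jacobson`). -/
def IsJNoetherian (R : Type*) [CommRing R] : Prop :=
  ∀ f : ℕ →o Ideal R, (∀ n, (f n).jacobson = f n) → ∃ n, ∀ m, n ≤ m → f m = f n

/-- A commutative ring `R` is an elementary divisor ring if every rectangular matrix over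
`R` can be reduced by invertible matrices to a diagonal matrix `D = (d_i)` with
`d_{i+1} R ⊆ d_i R`. -/
def IsElementaryDivisorRing (R : Type*) [CommRing R] : Prop :=
  ∀ (n m : ℕ) (A : Matrix (Fin n) (Fin m) R),
    ∃ (P : Matrix (Fin n) (Fin n) R) (Q : Matrix (Fin m) (Fin m) R),
      IsUnit P ∧ IsUnit Q ∧
      (∀ (i : Fin n) (j : Fin m), (i : ℕ) ≠ (j : ℕ) → (P * A * Q) i j = 0) ∧
      (∀ (i i' : Fin n) (j j' : Fin m), (i : ℕ) = (j : ℕ) → (i' : ℕ) = (j' : ℕ) →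
        (i' : ℕ) = (i : ℕ) + 1 → (P * A * Q) i j ∣ (P * A * Q) i' j')


section helpers
variable {R : Type*} [CommRing R]

theorem jn_bez [IsBezout R] (a b : R) : ∃ d x y a' b', d = a * x + b * y ∧ a = d * a' ∧ b = d * b' := by
  obtain ⟨d, hd⟩ := (IsBezout.span_pair_isPrincipal a b).principal
  have hd' : Ideal.span {a, b} = Ideal.span {d} := hd
  have h1 : d ∈ Ideal.span {a, b} := hd' ▸ Ideal.mem_span_singleton_self d
  have h2 : a ∈ Ideal.span {d} := hd' ▸ Ideal.subset_span (by simp)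
  have h3 : b ∈ Ideal.span {d} := hd' ▸ Ideal.subset_span (by simp)
  obtain ⟨x, y, hxy⟩ := Ideal.mem_span_pair.1 h1
  obtain ⟨a', ha⟩ := Ideal.mem_span_singleton.1 h2
  obtain ⟨b', hb⟩ := Ideal.mem_span_singleton.1 h3
  exact ⟨d, x, y, a', b', by rw [← hxy]; ring, ha, hb⟩

def JnT (I : Ideal R) : Prop :=
  (∀ a b c : R, (∀ M : Ideal R, M.IsMaximal → I ≤ M → a ∈ M → b ∈ M → c ∈ M → False) →
    ∃ s t : R, ∀ M : Ideal R, M.IsMaximal → I ≤ M → a + s * c ∈ M → b + t * c ∈ M → False) ∧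
  (∀ a b c : R, (∀ M : Ideal R, M.IsMaximal → I ≤ M → a ∈ M → b ∈ M → c ∈ M → False) →
    ∃ p q : R, ∀ M : Ideal R, M.IsMaximal → I ≤ M → p * a ∈ M → p * b + q * c ∈ M → False)

theorem jn_comparable [IsBezout R] {P Q M : Ideal R} (hP : P.IsPrime) (hQ : Q.IsPrime)
    (hM : M.IsMaximal) (hPM : P ≤ M) (hQM : Q ≤ M) : P ≤ Q ∨ Q ≤ P := by
  by_contra h
  push Not at h
  obtain ⟨x, hxP, hxQ⟩ := SetLike.not_le_iff_exists.1 h.1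
  obtain ⟨y, hyQ, hyP⟩ := SetLike.not_le_iff_exists.1 h.2
  obtain ⟨d, u, v, x', y', hd, hx, hy⟩ := jn_bez x y
  have hdP : d ∉ P := fun hh => hyP (hy ▸ P.mul_mem_right _ hh)
  have hdQ : d ∉ Q := fun hh => hxQ (hx ▸ Q.mul_mem_right _ hh)
  have hx' : x' ∈ P := (hP.mem_or_mem (hx ▸ hxP : d * x' ∈ P)).resolve_left hdP
  have hy' : y' ∈ Q := (hQ.mem_or_mem (hy ▸ hyQ : d * y' ∈ Q)).resolve_left hdQ
  have h0 : d * (1 - x' * u - y' * v) = 0 := by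
    have : d * (1 - x' * u - y' * v) = d - (d * x') * u - (d * y') * v := by ring
    rw [this, ← hx, ← hy, sub_sub, ← hd, sub_self]
  have h1 : 1 - x' * u - y' * v ∈ P :=
    (hP.mem_or_mem (h0 ▸ P.zero_mem : d * (1 - x' * u - y' * v) ∈ P)).resolve_left hdP
  apply hM.ne_top
  rw [Ideal.eq_top_iff_one]
  have : (1:R) = (1 - x' * u - y' * v) + x' * u + y' * v := by ring
  rw [this]
  exact M.add_mem (M.add_mem (hPM h1) (M.mul_mem_right _ (hPM hx'))) (M.mul_mem_right _ (hQM hy'))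

theorem jn_induction (hJ : IsJNoetherian R) (p : Ideal R → Prop)
    (h : ∀ I : Ideal R, I.jacobson = I → (∀ I' : Ideal R, I'.jacobson = I' → I < I' → p I') → p I) :
    ∀ I : Ideal R, I.jacobson = I → p I := by
  have wf : WellFoundedGT {I : Ideal R // I.jacobson = I} := by
    rw [wellFoundedGT_iff_monotone_chain_condition]
    intro f
    obtain ⟨n, hn⟩ := hJ ⟨fun n => (f n).1, fun a b hab => f.monotone hab⟩ (fun n => (f n).2)
    exact ⟨n, fun m hm => Subtype.ext (hn m hm).symm⟩
  intro I hI
  have := wf.wf.induction (C := fun I => p I.1) ⟨I, hI⟩ (by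
    rintro ⟨I, hI⟩ ih
    exact h I hI (fun I' hI' hlt => ih ⟨I', hI'⟩ hlt))
  exact this

theorem jn_le_of_max {I : Ideal R} (hI : I.jacobson = I) {x : R}
    (h : ∀ M : Ideal R, M.IsMaximal → I ≤ M → x ∈ M) : x ∈ I := by
  rw [← hI, Ideal.jacobson, Ideal.mem_sInf]
  exact fun {M} hM => h M hM.2 hM.1

theorem jn_jac_le {I M : Ideal R} (hM : M.IsMaximal) (h : I ≤ M) : I.jacobson ≤ M :=
  sInf_le ⟨h, hM⟩

theorem jn_prime [IsBezout R] (I : Ideal R) (hp : I.IsPrime)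
    (ih : ∀ I' : Ideal R, I'.jacobson = I' → I < I' → JnT I') : JnT I := by
  have S : ∀ a b c : R, (∀ M : Ideal R, M.IsMaximal → I ≤ M → a ∈ M → b ∈ M → c ∈ M → False) →
    ∃ s t : R, ∀ M : Ideal R, M.IsMaximal → I ≤ M → a + s * c ∈ M → b + t * c ∈ M → False := by
    intro a b c h
    by_cases hab : a ∈ I ∧ b ∈ I
    · refine ⟨1, 0, fun M hM hIM h1 h2 => h M hM hIM (hIM hab.1) (hIM hab.2) ?_⟩
      rw [one_mul] at h1
      exact (M.add_mem_iff_right (hIM hab.1)).1 h1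
    · obtain ⟨d, x, y, a', b', hd, ha, hb⟩ := jn_bez a b
      have hdI : d ∉ I := fun hh => hab ⟨ha ▸ I.mul_mem_right _ hh, hb ▸ I.mul_mem_right _ hh⟩
      have h0 : d * (1 - a' * x - b' * y) = 0 := by
        have : d * (1 - a' * x - b' * y) = d - (d * a') * x - (d * b') * y := by ring
        rw [this, ← ha, ← hb, sub_sub, ← hd, sub_self]
      have h1 : 1 - a' * x - b' * y ∈ I :=
        (hp.mem_or_mem (h0 ▸ I.zero_mem : d * (1 - a' * x - b' * y) ∈ I)).resolve_left hdI
      refine ⟨-y, x, fun M hM hIM h2 h3 => ?_⟩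
      have hdM : d ∈ M := by
        have : d = x * (a + -y * c) + y * (b + x * c) := by rw [hd]; ring
        rw [this]
        exact M.add_mem (M.mul_mem_left _ h2) (M.mul_mem_left _ h3)
      have hcM : c ∈ M := by
        have : c = a' * (b + x * c) - b' * (a + -y * c) + c * (1 - a' * x - b' * y) := by
          linear_combination b' * ha - a' * hb
        rw [this]
        exact M.add_mem (M.sub_mem (M.mul_mem_left _ h3) (M.mul_mem_left _ h2))
          (M.mul_mem_left _ (hIM h1))
      exact h M hM hIM (ha ▸ M.mul_mem_right _ hdM) (hb ▸ M.mul_mem_right _ hdM) hcM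
  refine ⟨S, ?_⟩
  intro a b c h
  by_cases ha : a ∈ I
  · obtain ⟨d, x, y, b', c', hd, hb, hc⟩ := jn_bez b c
    refine ⟨x, y, fun M hM hIM _ h2 => ?_⟩
    have hdM : d ∈ M := by
      rw [hd, mul_comm b, mul_comm c]; exact h2
    exact h M hM hIM (hIM ha) (hb ▸ M.mul_mem_right _ hdM) (hc ▸ M.mul_mem_right _ hdM)
  by_cases hc : c ∈ I
  · refine ⟨1, 0, fun M hM hIM h1 h2 => h M hM hIM (by simpa using h1) (by simpa using h2) (hIM hc)⟩
  have hac : a * c ∉ I := fun hh => (hp.mem_or_mem hh).elim ha hc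
  have hle : I ⊔ Ideal.span {a * c} ≤ (I ⊔ Ideal.span {a * c}).jacobson := Ideal.le_jacobson
  have hlt : I < (I ⊔ Ideal.span {a * c}).jacobson := by
    refine lt_of_le_of_ne (le_sup_left.trans hle) (fun heq => hac ?_)
    rw [heq]
    exact hle (Ideal.mem_sup_right (Ideal.mem_span_singleton_self _))
  have hM' : ∀ M : Ideal R, M.IsMaximal → I ≤ M → a * c ∈ M →
      (I ⊔ Ideal.span {a * c}).jacobson ≤ M := by
    intro M hM hIM hm
    exact jn_jac_le hM (sup_le hIM ((Ideal.span_singleton_le_iff_mem M).2 hm))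
  obtain ⟨p, q, hpq⟩ := (ih _ Ideal.jacobson_idem hlt).2 a b c
    (fun M hM hIM => h M hM (hlt.le.trans hIM))
  obtain ⟨s, t, hst⟩ := S p q (a * c) (fun M hM hIM h1 h2 h3 =>
    hpq M hM (hM' M hM hIM h3) (M.mul_mem_right _ h1)
      (M.add_mem (M.mul_mem_right _ h1) (M.mul_mem_right _ h2)))
  refine ⟨p + s * (a * c), q + t * (a * c), fun M hM hIM h1 h2 => ?_⟩
  have hacM : a * c ∈ M := by
    rcases hM.isPrime.mem_or_mem h1 with h3 | h3
    · have h4 : (q + t * (a * c)) * c ∈ M :=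
        (M.add_mem_iff_right (M.mul_mem_right _ h3)).1 h2
      rcases hM.isPrime.mem_or_mem h4 with h5 | h5
      · exact (hst M hM hIM h3 h5).elim
      · exact M.mul_mem_left _ h5
    · exact M.mul_mem_right _ h3
  refine hpq M hM (hM' M hM hIM hacM) ?_ ?_
  · have : p * a = (p + s * (a * c)) * a - (a * c) * (s * a) := by ring
    rw [this]
    exact M.sub_mem h1 (M.mul_mem_right _ hacM)
  · have : p * b + q * c = ((p + s * (a * c)) * b + (q + t * (a * c)) * c)
      - (a * c) * (s * b + t * c) := by ring
    rw [this]
    exact M.sub_mem h2 (M.mul_mem_right _ hacM)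

theorem jn_mem_sub {M : Ideal R} {x y : R} (h : x ∈ M) (h' : x - y ∈ M) : y ∈ M := by
  have := M.sub_mem h h'
  simpa using this

theorem jn_crt (I P Q : Ideal R) (hI : P ⊓ Q ≤ I) (hIP : I ≤ P) (hIQ : I ≤ Q)
    (hPQ : P ⊔ Q = ⊤) (TP : JnT P) (TQ : JnT Q) : JnT I := by
  obtain ⟨e, he, f, hf, hef⟩ := Submodule.mem_sup.1 ((Ideal.eq_top_iff_one _).1 hPQ)
  have key : ∀ M : Ideal R, M.IsMaximal → I ≤ M → P ≤ M ∨ Q ≤ M := fun M hM hIM =>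
    hM.isPrime.inf_le.1 (hI.trans hIM)
  have k1 : ∀ M : Ideal R, P ≤ M → ∀ x y : R, (f * x + e * y) - x ∈ M := by
    intro M hM x y
    have : (f * x + e * y) - x = e * (y - x) := by linear_combination x * hef
    rw [this]; exact M.mul_mem_right _ (hM he)
  have k2 : ∀ M : Ideal R, Q ≤ M → ∀ x y : R, (f * x + e * y) - y ∈ M := by
    intro M hM x y
    have : (f * x + e * y) - y = f * (x - y) := by linear_combination y * hef
    rw [this]; exact M.mul_mem_right _ (hM hf)
  constructor
  · intro a b c h
    obtain ⟨s1, t1, h1⟩ := TP.1 a b c (fun M hM hIM => h M hM (hIP.trans hIM))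
    obtain ⟨s2, t2, h2⟩ := TQ.1 a b c (fun M hM hIM => h M hM (hIQ.trans hIM))
    refine ⟨f * s1 + e * s2, f * t1 + e * t2, fun M hM hIM h3 h4 => ?_⟩
    rcases key M hM hIM with h5 | h5
    · refine h1 M hM h5 (jn_mem_sub h3 ?_) (jn_mem_sub h4 ?_)
      · convert M.mul_mem_right c (k1 M h5 s1 s2) using 1; ring
      · convert M.mul_mem_right c (k1 M h5 t1 t2) using 1; ring
    · refine h2 M hM h5 (jn_mem_sub h3 ?_) (jn_mem_sub h4 ?_)
      · convert M.mul_mem_right c (k2 M h5 s1 s2) using 1; ring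
      · convert M.mul_mem_right c (k2 M h5 t1 t2) using 1; ring
  · intro a b c h
    obtain ⟨s1, t1, h1⟩ := TP.2 a b c (fun M hM hIM => h M hM (hIP.trans hIM))
    obtain ⟨s2, t2, h2⟩ := TQ.2 a b c (fun M hM hIM => h M hM (hIQ.trans hIM))
    refine ⟨f * s1 + e * s2, f * t1 + e * t2, fun M hM hIM h3 h4 => ?_⟩
    rcases key M hM hIM with h5 | h5
    · refine h1 M hM h5 (jn_mem_sub h3 ?_) (jn_mem_sub h4 ?_)
      · convert M.mul_mem_right a (k1 M h5 s1 s2) using 1; ring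
      · convert M.add_mem (M.mul_mem_right b (k1 M h5 s1 s2))
          (M.mul_mem_right c (k1 M h5 t1 t2)) using 1; ring
    · refine h2 M hM h5 (jn_mem_sub h3 ?_) (jn_mem_sub h4 ?_)
      · convert M.mul_mem_right a (k2 M h5 s1 s2) using 1; ring
      · convert M.add_mem (M.mul_mem_right b (k2 M h5 s1 s2))
          (M.mul_mem_right c (k2 M h5 t1 t2)) using 1; ring

theorem jn_finite (hJ : IsJNoetherian R) : ∀ I : Ideal R, I.jacobson = I →
    ∃ S : Finset (Ideal R), (∀ P ∈ S, P.IsPrime ∧ P.jacobson = P) ∧ S.inf id = I := by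
  classical
  apply jn_induction hJ
  intro I hI ih
  by_cases htop : I = ⊤
  · exact ⟨∅, by simp, by simp [htop]⟩
  by_cases hp : I.IsPrime
  · exact ⟨{I}, by simpa using ⟨hp, hI⟩, by simp⟩
  rw [Ideal.isPrime_iff] at hp
  push Not at hp
  obtain ⟨x, y, hxy, hx, hy⟩ := hp htop
  have aux : ∀ z, z ∉ I → I < (I ⊔ Ideal.span {z}).jacobson := by
    intro z hz
    refine lt_of_le_of_ne (le_sup_left.trans Ideal.le_jacobson) (fun heq => hz ?_)
    rw [heq]
    exact Ideal.le_jacobson (Ideal.mem_sup_right (Ideal.mem_span_singleton_self _))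
  obtain ⟨S, hS, hS'⟩ := ih _ Ideal.jacobson_idem (aux x hx)
  obtain ⟨S2, hS2, hS2'⟩ := ih _ Ideal.jacobson_idem (aux y hy)
  refine ⟨S ∪ S2, fun P hP => (Finset.mem_union.1 hP).elim (hS P) (hS2 P), ?_⟩
  rw [Finset.inf_union, hS', hS2']
  apply le_antisymm
  · intro z hz
    apply jn_le_of_max hI
    intro M hM hIM
    rcases hM.isPrime.mem_or_mem (hIM hxy) with h | h
    · exact jn_jac_le hM (sup_le hIM ((Ideal.span_singleton_le_iff_mem M).2 h)) hz.1
    · exact jn_jac_le hM (sup_le hIM ((Ideal.span_singleton_le_iff_mem M).2 h)) hz.2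
  · exact le_inf (aux x hx).le (aux y hy).le

theorem jn_main [IsBezout R] (hJ : IsJNoetherian R) : ∀ I : Ideal R, I.jacobson = I → JnT I := by
  classical
  apply jn_induction hJ
  intro I hI ih
  by_cases hp : I.IsPrime
  · exact jn_prime I hp ih
  obtain ⟨S, hS, hSI⟩ := jn_finite hJ I hI
  by_cases hne : S.Nonempty
  swap
  · rw [Finset.not_nonempty_iff_eq_empty] at hne
    subst hne
    have : I = ⊤ := by simpa using hSI.symm
    subst this
    have : ∀ M : Ideal R, M.IsMaximal → ⊤ ≤ M → False := fun M hM h => hM.ne_top (top_le_iff.1 h)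
    exact ⟨fun a b c _ => ⟨0, 0, fun M hM h _ _ => this M hM h⟩,
      fun a b c _ => ⟨0, 0, fun M hM h _ _ => this M hM h⟩⟩
  obtain ⟨P, hPmin⟩ := S.exists_minimal hne
  have hPS := hPmin.prop
  set Q := (S.filter (fun Q => ¬ P ≤ Q)).inf id with hQ
  have hIP : I ≤ P := by rw [← hSI]; exact Finset.inf_le (f := id) hPS
  have hIQ : I ≤ Q := by rw [← hSI]; exact Finset.inf_mono (Finset.filter_subset _ _)
  have hPQI : P ⊓ Q ≤ I := by
    rw [← hSI]
    apply Finset.le_inf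
    intro L hL
    by_cases h : P ≤ L
    · exact inf_le_left.trans h
    · exact inf_le_right.trans (Finset.inf_le (f := id) (Finset.mem_filter.2 ⟨hL, h⟩))
  have hPQ : P ⊔ Q = ⊤ := by
    by_contra h
    obtain ⟨M, hM, hle⟩ := Ideal.exists_le_maximal _ h
    have h1 : P ≤ M := le_sup_left.trans hle
    have h2 : Q ≤ M := le_sup_right.trans hle
    rw [hQ, hM.isPrime.inf_le'] at h2
    obtain ⟨L, hL, hLM⟩ := h2
    rw [Finset.mem_filter] at hL
    rcases jn_comparable (hS P hPS).1 (hS L hL.1).1 hM h1 hLM with h3 | h3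
    · exact hL.2 h3
    · exact hL.2 (hPmin.le_of_le hL.1 h3)
  have hQJ : Q.jacobson = Q := by
    refine le_antisymm ?_ Ideal.le_jacobson
    refine Finset.le_inf fun L hL => ?_
    have : Q.jacobson ≤ L.jacobson := Ideal.jacobson_mono (Finset.inf_le (f := id) hL)
    rwa [(hS L (Finset.mem_filter.1 hL).1).2] at this
  have hP1 : I < P := lt_of_le_of_ne hIP (fun h => hp (h ▸ (hS P hPS).1))
  have hQ1 : I < Q := lt_of_le_of_ne hIQ (fun h => by
    rw [← h, sup_eq_left.2 hIP] at hPQ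
    exact (hS P hPS).1.ne_top hPQ)
  exact jn_crt I P Q hPQI hIP hIQ hPQ (ih P (hS P hPS).2 hP1) (ih Q hQJ hQ1)

theorem jn_coprime {x y : R} (h : ∀ M : Ideal R, M.IsMaximal → x ∈ M → y ∈ M → False) :
    ∃ u v, x * u + y * v = 1 := by
  have : Ideal.span {x, y} = ⊤ := by
    by_contra hne
    obtain ⟨M, hM, hle⟩ := Ideal.exists_le_maximal _ hne
    exact h M hM (hle (Ideal.subset_span (by simp))) (hle (Ideal.subset_span (by simp)))
  obtain ⟨u, v, huv⟩ := Ideal.mem_span_pair.1 ((Ideal.eq_top_iff_one _).1 this)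
  exact ⟨u, v, by rw [← huv]; ring⟩

/-- Hermite property -/
def JnHer (R : Type*) [CommRing R] : Prop :=
  ∀ a b : R, ∃ d a' b' x y, a = d * a' ∧ b = d * b' ∧ a' * x + b' * y = 1

theorem jn_her [IsBezout R] (hJ : IsJNoetherian R) : JnHer R := by
  intro a b
  obtain ⟨d, x, y, a', b', hd, ha, hb⟩ := jn_bez a b
  obtain ⟨s, t, hst⟩ := (jn_main hJ (Ideal.jacobson ⊥) Ideal.jacobson_idem).1 a' b'
    (1 - a' * x - b' * y) (by
      intro M hM _ h1 h2 h3
      apply hM.ne_top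
      rw [Ideal.eq_top_iff_one]
      have : (1:R) = (1 - a' * x - b' * y) + a' * x + b' * y := by ring
      rw [this]
      exact M.add_mem (M.add_mem h3 (M.mul_mem_right _ h1)) (M.mul_mem_right _ h2))
  obtain ⟨u, v, huv⟩ := jn_coprime (fun M hM => hst M hM (jn_jac_le hM bot_le))
  have h0 : d * (1 - a' * x - b' * y) = 0 := by
    have : d * (1 - a' * x - b' * y) = d - (d * a') * x - (d * b') * y := by ring
    rw [this, ← ha, ← hb, sub_sub, ← hd, sub_self]
  exact ⟨d, _, _, u, v, by linear_combination ha - s * h0, by linear_combination hb - t * h0, huv⟩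

theorem jn_vec (hH : JnHer R) : ∀ (n : ℕ) (r : Fin (n + 1) → R),
    ∃ (a : R) (r1 y : Fin (n + 1) → R), (∀ i, r i = a * r1 i) ∧ ∑ i, r1 i * y i = 1 := by
  intro n
  induction n with
  | zero => exact fun r => ⟨r 0, fun _ => 1, fun _ => 1, fun i => by
      have : i = 0 := Fin.ext (by omega)
      simp [this], by simp⟩
  | succ n ih =>
    intro r
    obtain ⟨a, r1, y, h1, h2⟩ := ih (fun i => r i.succ)
    obtain ⟨d, h', a', x, z, hh, ha, hxz⟩ := hH (r 0) a
    refine ⟨d, Fin.cons h' (fun i => a' * r1 i), Fin.cons x (fun i => z * y i), ?_, ?_⟩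
    · intro i
      refine Fin.cases ?_ (fun i => ?_) i
      · simpa using hh
      · simp [h1 i, ha, mul_assoc]
    · rw [Fin.sum_univ_succ]
      simp only [Fin.cons_zero, Fin.cons_succ]
      have : ∑ i, a' * r1 i * (z * y i) = (a' * z) * ∑ i, r1 i * y i := by
        rw [Finset.mul_sum]; exact Finset.sum_congr rfl fun i _ => by ring
      rw [this, h2, mul_one, hxz]

theorem jn_vec' (hH : JnHer R) {ι : Type*} [Fintype ι] [Nonempty ι] (r : ι → R) :
    ∃ (a : R) (r1 y : ι → R), (∀ i, r i = a * r1 i) ∧ ∑ i, r1 i * y i = 1 := by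
  obtain ⟨n, hn⟩ : ∃ n, Fintype.card ι = n + 1 :=
    ⟨Fintype.card ι - 1, (Nat.succ_pred_eq_of_pos Fintype.card_pos).symm⟩
  let e : ι ≃ Fin (n + 1) := Fintype.equivFinOfCardEq hn
  obtain ⟨a, r1, y, h1, h2⟩ := jn_vec hH n (fun i => r (e.symm i))
  refine ⟨a, fun i => r1 (e i), fun i => y (e i), fun i => by simpa using h1 (e i), ?_⟩
  rw [← h2]
  exact Equiv.sum_comp e (fun i => r1 i * y i)

/-- Kaplansky's condition, general form -/
def JnK (R : Type*) [CommRing R] : Prop :=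
  ∀ a b c : R, ∃ p q : R, ∀ J : Ideal R, p * a + q * b ∈ J → q * c ∈ J → a ∈ J ∧ b ∈ J ∧ c ∈ J

theorem jn_K [IsBezout R] (hJ : IsJNoetherian R) : JnK R := by
  intro a b c
  obtain ⟨d, r, y, h1, h2⟩ := jn_vec (jn_her hJ) 2 ![a, b, c]
  have ha : a = d * r 0 := h1 0
  have hb : b = d * r 1 := h1 1
  have hc : c = d * r 2 := h1 2
  rw [Fin.sum_univ_three] at h2
  obtain ⟨q, p, hpq⟩ := (jn_main hJ (Ideal.jacobson ⊥) Ideal.jacobson_idem).2 (r 2) (r 1) (r 0) (by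
    intro M hM _ h3 h4 h5
    apply hM.ne_top
    rw [Ideal.eq_top_iff_one, ← h2]
    exact M.add_mem (M.add_mem (M.mul_mem_right _ h5) (M.mul_mem_right _ h4)) (M.mul_mem_right _ h3))
  obtain ⟨u, v, huv⟩ := jn_coprime (fun M hM => hpq M hM (jn_jac_le hM bot_le))
  refine ⟨p, q, fun J h3 h4 => ?_⟩
  have hd : d ∈ J := by
    have : d = (q * c) * u + (p * a + q * b) * v := by
      linear_combination (-d) * huv - (p * v) * ha - q * v * hb - q * u * hc
    rw [this]
    exact J.add_mem (J.mul_mem_right _ h4) (J.mul_mem_right _ h3)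
  exact ⟨ha ▸ J.mul_mem_right _ hd, hb ▸ J.mul_mem_right _ hd, hc ▸ J.mul_mem_right _ hd⟩

theorem jn_two [IsBezout R] (hH : JnHer R) (hK : JnK R) {m : ℕ} (r s : Fin (m + 1) → R) :
    ∃ p q : R, ∀ J : Ideal R, (∀ j, p * r j + q * s j ∈ J) → ∀ j, r j ∈ J ∧ s j ∈ J := by
  obtain ⟨a, r1, y, hr, hy⟩ := jn_vec hH m r
  set b := ∑ j, s j * y j with hb
  obtain ⟨c, s1, z, hs, hz⟩ := jn_vec hH m (fun j => s j - b * r1 j)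
  obtain ⟨p, q, hpq⟩ := hK a b c
  refine ⟨p, q, fun J hJ => ?_⟩
  have e1 : p * a + q * b ∈ J := by
    have : p * a + q * b = ∑ j, (p * r j + q * s j) * y j := by
      have : ∀ j, (p * r j + q * s j) * y j = (p * a) * (r1 j * y j) + q * (s j * y j) := by
        intro j; rw [hr j]; ring
      simp only [this, Finset.sum_add_distrib, ← Finset.mul_sum, hy, ← hb, mul_one]
    rw [this]
    exact J.sum_mem fun j _ => J.mul_mem_right _ (hJ j)
  have e2 : ∀ j, q * (c * s1 j) ∈ J := by
    intro j
    have : q * (c * s1 j) = (p * r j + q * s j) - (p * a + q * b) * r1 j := by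
      rw [← hs j, hr j]; ring
    rw [this]
    exact J.sub_mem (hJ j) (J.mul_mem_right _ e1)
  have e3 : q * c ∈ J := by
    have : q * c = ∑ j, (q * (c * s1 j)) * z j := by
      have : ∀ j, (q * (c * s1 j)) * z j = (q * c) * (s1 j * z j) := by intro j; ring
      simp only [this, ← Finset.mul_sum, hz, mul_one]
    rw [this]
    exact J.sum_mem fun j _ => J.mul_mem_right _ (e2 j)
  obtain ⟨h1, h2, h3⟩ := hpq J e1 e3
  intro j
  refine ⟨hr j ▸ J.mul_mem_right _ h1, ?_⟩
  have : s j = c * s1 j + b * r1 j := by rw [← hs j]; ring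
  rw [this]
  exact J.add_mem (J.mul_mem_right _ h3) (J.mul_mem_right _ h2)

theorem jn_row [IsBezout R] (hH : JnHer R) (hK : JnK R) {m : ℕ} : ∀ (n : ℕ)
    (A : Fin n → Fin (m + 1) → R),
    ∃ u : Fin n → R, ∀ J : Ideal R, (∀ j, ∑ i, u i * A i j ∈ J) → ∀ i j, A i j ∈ J := by
  intro n
  induction n with
  | zero => exact fun A => ⟨0, fun J _ i => i.elim0⟩
  | succ n ih =>
    intro A
    obtain ⟨u, hu⟩ := ih (fun i => A i.succ)
    obtain ⟨p, q, hpq⟩ := jn_two hH hK (A 0) (fun j => ∑ i, u i * A i.succ j)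
    refine ⟨Fin.cons p (fun i => q * u i), fun J hJ => ?_⟩
    have h1 := hpq J (fun j => by
      have := hJ j
      rw [Fin.sum_univ_succ] at this
      simpa [Finset.mul_sum, mul_assoc] using this)
    have h2 := hu J (fun j => (h1 j).2)
    intro i j
    refine Fin.cases ?_ (fun i => ?_) i
    · exact (h1 j).1
    · exact h2 i j

theorem jn_uAv [IsBezout R] (hH : JnHer R) (hK : JnK R) {n m : ℕ}
    (A : Matrix (Fin (n + 1)) (Fin (m + 1)) R) :
    ∃ (d : R) (B : Matrix (Fin (n + 1)) (Fin (m + 1)) R) (u : Fin (n + 1) → R)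
      (v : Fin (m + 1) → R), A = d • B ∧ u ⬝ᵥ (B.mulVec v) = 1 := by
  obtain ⟨d, r1, y, h1, h2⟩ := jn_vec' hH (fun x : Fin (n + 1) × Fin (m + 1) => A x.1 x.2)
  obtain ⟨u, hu⟩ := jn_row hH hK (n + 1) (fun i j => r1 (i, j))
  have h3 := hu (Ideal.span (Set.range fun j => ∑ i, u i * r1 (i, j)))
    (fun j => Ideal.subset_span ⟨j, rfl⟩)
  have h4 : (1 : R) ∈ Ideal.span (Set.range fun j => ∑ i, u i * r1 (i, j)) := by
    rw [← h2]
    exact Ideal.sum_mem _ fun x _ => Ideal.mul_mem_right _ _ (h3 x.1 x.2)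
  obtain ⟨v, hv⟩ := (Ideal.mem_span_range_iff_exists_fun).1 h4
  refine ⟨d, Matrix.of fun i j => r1 (i, j), u, v, ?_, ?_⟩
  · ext i j; exact h1 (i, j)
  · rw [← hv]
    simp only [dotProduct, Matrix.mulVec, Matrix.of_apply, Finset.mul_sum]
    rw [Finset.sum_comm]
    exact Finset.sum_congr rfl fun i _ => Finset.sum_congr rfl fun j _ => by ring

def JnHerMod (R M : Type*) [CommRing R] [AddCommGroup M] [Module R M] : Prop :=
  ∀ v : R × M, ∃ (e : (R × M) ≃ₗ[R] (R × M)) (d : R), e v = (d, 0)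

/-- the 2 x 2 operation on the first two coordinates -/
def jnGivens {M : Type*} [AddCommGroup M] [Module R M] (a b x y : R) (h : a * x + b * y = 1) :
    (R × (R × M)) ≃ₗ[R] (R × (R × M)) where
  toFun z := (x * z.1 + y * z.2.1, (-b * z.1 + a * z.2.1, z.2.2))
  invFun z := (a * z.1 - y * z.2.1, (b * z.1 + x * z.2.1, z.2.2))
  map_add' z w := by
    ext
    · simp; ring
    · simp; ring
    · simp
  map_smul' c z := by
    ext
    · simp; ring
    · simp; ring
    · simp
  left_inv z := by
    ext
    · simp; linear_combination z.1 * h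
    · simp; linear_combination z.2.1 * h
    · simp
  right_inv z := by
    ext
    · simp; linear_combination z.1 * h
    · simp; linear_combination z.2.1 * h
    · simp

theorem jn_hermod_succ (hH : JnHer R) {M : Type*} [AddCommGroup M] [Module R M]
    (hM : JnHerMod R M) : JnHerMod R (R × M) := by
  rintro ⟨h, w⟩
  obtain ⟨e, t, he⟩ := hM w
  obtain ⟨d, a, b, x, y, ha, hb, hxy⟩ := hH h t
  refine ⟨(LinearEquiv.prodCongr (LinearEquiv.refl R R) e).trans (jnGivens a b x y hxy), d, ?_⟩
  have : (LinearEquiv.prodCongr (LinearEquiv.refl R R) e) (h, w) = (h, (t, 0)) := by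
    simp [he]
  rw [LinearEquiv.trans_apply, this]
  ext
  · simp [jnGivens]; linear_combination x * ha + y * hb + d * hxy
  · simp [jnGivens]; linear_combination -b * ha + a * hb
  · simp [jnGivens]

theorem jn_hermod_congr {M N : Type*} [AddCommGroup M] [Module R M] [AddCommGroup N] [Module R N]
    (f : M ≃ₗ[R] N) (hM : JnHerMod R M) : JnHerMod R N := by
  intro v
  let F := LinearEquiv.prodCongr (LinearEquiv.refl R R) f
  obtain ⟨e, d, he⟩ := hM (F.symm v)
  refine ⟨(F.symm.trans e).trans F, d, ?_⟩
  simp only [LinearEquiv.trans_apply, he]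
  simp [F]

theorem jn_hermod_fin (hH : JnHer R) (n : ℕ) : JnHerMod R (Fin n → R) := by
  induction n with
  | zero => exact fun v => ⟨LinearEquiv.refl R _, v.1, by ext i <;> [rfl; exact i.elim0]⟩
  | succ n ih =>
    exact jn_hermod_congr (Fin.consLinearEquiv R (fun _ : Fin (n + 1) => R)) (jn_hermod_succ hH ih)

def jnScale {M : Type*} [AddCommGroup M] [Module R M] (d k : R) (h : d * k = 1)
    (ψ : M →ₗ[R] R) : (R × M) ≃ₗ[R] (R × M) where
  toFun z := (d * (z.1 - ψ z.2), z.2)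
  invFun z := (k * z.1 + ψ z.2, z.2)
  map_add' z w := by
    ext
    · simp; ring
    · simp
  map_smul' c z := by
    ext
    · simp; ring
    · simp
  left_inv z := by
    ext
    · simp; linear_combination (z.1 - ψ z.2) * h
    · simp
  right_inv z := by
    ext
    · simp; linear_combination z.1 * h
    · simp

theorem jn_complete {M : Type*} [AddCommGroup M] [Module R M] (hM : JnHerMod R M)
    (φ : (R × M) →ₗ[R] R) (v : R × M) (hv : φ v = 1) :
    ∃ E : (R × M) ≃ₗ[R] (R × M), E (1, 0) = v ∧ ∀ z, φ (E z) = z.1 := by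
  obtain ⟨e, d, he⟩ := hM v
  set k := φ (e.symm (1, 0)) with hk
  have hev : e.symm (d, 0) = v := by rw [← he]; simp
  have hs : ∀ c : R, φ (e.symm (c, 0)) = c * k := by
    intro c
    have : ((c, 0) : R × M) = c • ((1, 0) : R × M) := by ext <;> simp
    rw [this, map_smul, map_smul, smul_eq_mul]
  have hdk : d * k = 1 := by rw [← hs, hev, hv]
  let ψ : M →ₗ[R] R := φ ∘ₗ e.symm.toLinearMap ∘ₗ LinearMap.inr R R M
  refine ⟨(jnScale d k hdk ψ).trans e.symm, ?_, ?_⟩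
  · rw [LinearEquiv.trans_apply, ← hev]
    simp [jnScale]
  · rintro ⟨x, m⟩
    rw [LinearEquiv.trans_apply]
    have : jnScale d k hdk ψ (x, m) = (d * (x - ψ m), 0) + (0, m) := by
      simp [jnScale]
    rw [this, map_add, map_add, hs]
    have : φ (e.symm (0, m)) = ψ m := rfl
    rw [this]
    linear_combination (x - ψ m) * hdk

theorem jn_smith [IsBezout R] (hH : JnHer R) (hK : JnK R) : ∀ (n m : ℕ)
    (f : (Fin m → R) →ₗ[R] (Fin n → R)),
    ∃ (e1 : (Fin m → R) ≃ₗ[R] (Fin m → R)) (e2 : (Fin n → R) ≃ₗ[R] (Fin n → R)) (δ : ℕ → R),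
      (∀ k, δ k ∣ δ (k + 1)) ∧
      ∀ x i, e2 (f (e1 x)) i = if h : (i : ℕ) < m then δ i * x ⟨i, h⟩ else 0 := by
  intro n
  induction n with
  | zero => exact fun m f => ⟨LinearEquiv.refl R _, LinearEquiv.refl R _, 0, by simp, fun x i => i.elim0⟩
  | succ n ih =>
    intro m f
    cases m with
    | zero =>
      refine ⟨LinearEquiv.refl R _, LinearEquiv.refl R _, 0, by simp, fun x i => ?_⟩
      have : x = 0 := Subsingleton.elim _ _
      subst this
      rw [map_zero, map_zero, map_zero]
      simp
    | succ m =>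
      obtain ⟨d, B, u, v, hA, huv⟩ := jn_uAv hH hK (LinearMap.toMatrix' f)
      have hf : ∀ x, f x = d • B.mulVec x := by
        intro x
        rw [← LinearMap.toMatrix'_mulVec f x, hA, Matrix.smul_mulVec]
      let CM := Fin.consLinearEquiv R (fun _ : Fin (m + 1) => R)
      let CN := Fin.consLinearEquiv R (fun _ : Fin (n + 1) => R)
      let φ : (Fin (n + 1) → R) →ₗ[R] R := dotProductBilin R R u
      have hφ : ∀ x, φ x = u ⬝ᵥ x := fun x => rfl
      obtain ⟨EM, hEM1, hEM2⟩ := jn_complete (jn_hermod_fin hH m)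
        (φ ∘ₗ B.mulVecLin ∘ₗ CM.toLinearMap) (CM.symm v) (by simpa [hφ] using huv)
      obtain ⟨EN, hEN1, hEN2⟩ := jn_complete (jn_hermod_fin hH n)
        (φ ∘ₗ CN.toLinearMap) (CN.symm (B.mulVec v)) (by simpa [hφ] using huv)
      let g : (R × (Fin m → R)) →ₗ[R] (R × (Fin n → R)) :=
        EN.symm.toLinearMap ∘ₗ CN.symm.toLinearMap ∘ₗ B.mulVecLin ∘ₗ CM.toLinearMap ∘ₗ EM.toLinearMap
      have hg : ∀ z, g z = EN.symm (CN.symm (B.mulVec (CM (EM z)))) := fun z => rfl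
      have g1 : g (1, 0) = (1, 0) := by
        rw [hg, hEM1, LinearEquiv.apply_symm_apply, ← hEN1, LinearEquiv.symm_apply_apply]
      have g2 : ∀ z, (g z).1 = z.1 := by
        intro z
        rw [← hEN2, ← hEM2 z, hg]
        simp
      let h : (Fin m → R) →ₗ[R] (Fin n → R) :=
        LinearMap.snd R R _ ∘ₗ g ∘ₗ LinearMap.inr R R _
      have g3 : ∀ x y, g (x, y) = (x, h y) := by
        intro x y
        have : ((x, y) : R × (Fin m → R)) = x • (1, 0) + (0, y) := by simp
        apply Prod.ext
        · exact g2 _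
        · rw [this, map_add, map_smul, g1]
          simp [h]
      obtain ⟨e1, e2, δ, hδ, hh⟩ := ih m h
      let F1 := ((CM.symm.trans (LinearEquiv.prodCongr (LinearEquiv.refl R R) e1)).trans EM).trans CM
      let F2 := ((CN.symm.trans EN.symm).trans
        (LinearEquiv.prodCongr (LinearEquiv.refl R R) e2)).trans CN
      refine ⟨F1, F2, fun k => Nat.casesOn k d (fun k => d * δ k), ?_, ?_⟩
      · intro k
        cases k with
        | zero => exact Dvd.intro _ rfl
        | succ k => exact mul_dvd_mul_left d (hδ k)
      · intro x i
        have key : F2 (f (F1 x)) = d • CN (x 0, e2 (h (e1 (fun i => x i.succ)))) := by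
          have c1 : CM.symm x = (x 0, fun i => x i.succ) := rfl
          have c2 : F1 x = CM (EM (x 0, e1 (fun i => x i.succ))) := by
            simp only [F1, LinearEquiv.trans_apply, c1]; rfl
          rw [hf, map_smul, c2]
          congr 1
          have c3 : ∀ w, F2 w = CN ((LinearEquiv.prodCongr (LinearEquiv.refl R R) e2)
            (EN.symm (CN.symm w))) := fun w => rfl
          rw [c3, ← hg, g3]
          rfl
        rw [key]
        have c4 : ∀ a w, CN (a, w) = Fin.cons a w := fun a w => rfl
        rw [c4, Pi.smul_apply, smul_eq_mul]
        refine Fin.cases ?_ (fun i => ?_) i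
        · simp
        · rw [Fin.cons_succ, hh]
          by_cases hi : (i : ℕ) < m
          · simp [hi, mul_assoc]
          · simp [hi]

end helpers

theorem jNoetherian_bezout_is_edr (R : Type*) [CommRing R] [IsBezout R]
    (hJ : IsJNoetherian R) : IsElementaryDivisorRing R := by
  intro n m A
  obtain ⟨e1, e2, δ, hδ, h⟩ := jn_smith (jn_her hJ) (jn_K hJ) n m A.mulVecLin
  have hunit : ∀ {k : ℕ} (e : (Fin k → R) ≃ₗ[R] (Fin k → R)),
      IsUnit (LinearMap.toMatrix' e.toLinearMap) := by
    intro k e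
    refine IsUnit.of_mul_eq_one (LinearMap.toMatrix' e.symm.toLinearMap) ?_
    rw [← LinearMap.toMatrix'_comp]
    simp
  have key : ∀ (i : Fin n) (j : Fin m),
      (LinearMap.toMatrix' e2.toLinearMap * A * LinearMap.toMatrix' e1.toLinearMap) i j =
        if (i : ℕ) = (j : ℕ) then δ i else 0 := by
    intro i j
    have : LinearMap.toMatrix' e2.toLinearMap * A * LinearMap.toMatrix' e1.toLinearMap =
        LinearMap.toMatrix' (e2.toLinearMap ∘ₗ A.mulVecLin ∘ₗ e1.toLinearMap) := by
      rw [LinearMap.toMatrix'_comp, LinearMap.toMatrix'_comp, ← Matrix.toLin'_apply',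
        LinearMap.toMatrix'_toLin', Matrix.mul_assoc]
    rw [this, LinearMap.toMatrix'_apply]
    have h2 := h (Pi.single j 1) i
    simp only [LinearMap.comp_apply, LinearEquiv.coe_coe]
    refine (Eq.trans ?_ h2).trans ?_
    · congr 4
    · by_cases hij : (i : ℕ) = (j : ℕ)
      · have : (i : ℕ) < m := hij ▸ j.2
        simp [hij]
      · by_cases hi : (i : ℕ) < m
        · have : (⟨i, hi⟩ : Fin m) ≠ j := fun hh => hij (by rw [← hh])
          simp [hi, hij, this]
        · simp [hi, hij]
  refine ⟨_, _, hunit e2, hunit e1, ?_, ?_⟩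
  · intro i j hij
    rw [key, if_neg hij]
  · intro i i' j j' h1 h2 h3
    rw [key, key, if_pos h1, if_pos h2, h3]
    exact hδ i
end

section
/- Let R be a Bezout domain. Then R is an elementary divisor ring if and only if for any elements x, y, z, t ∈ R with xR + yR = R and zR + tR = R there exists an element λ ∈ R such that x + λy = r·s where rR + zR = R, sR + tR = R and rR + sR = R. -/
namespace NeatEDR

open Matrix

/-- Kaplansky condition. -/
def K (R : Type*) [CommRing R] : Prop :=
  ∀ a b c : R, (∃ f g h : R, a * f + b * g + c * h = 1) →
    ∃ p q u v : R, p * a * u + p * b * v + q * c * v = 1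

theorem span_iff {R : Type*} [CommRing R] (x y : R) :
    Ideal.span {x} + Ideal.span {y} = ⊤ ↔ IsCoprime x y := by
  rw [← Ideal.isCoprime_span_singleton_iff, Ideal.isCoprime_iff_add, Ideal.one_eq_top]

/-- gcd in Bezout domain -/
theorem gcd2 {R : Type*} [CommRing R] [IsDomain R] [IsBezout R] (a c : R) :
    ∃ d a' c' x y : R, a = d * a' ∧ c = d * c' ∧ a' * x + c' * y = 1 := by
  by_cases h : a = 0 ∧ c = 0
  · exact ⟨0, 1, 1, 1, 0, by simp [h.1], by simp [h.2], by ring⟩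
  · obtain ⟨x, y, hxy⟩ := IsBezout.gcd_eq_sum a c
    obtain ⟨a', ha⟩ := IsBezout.gcd_dvd_left a c
    obtain ⟨c', hc⟩ := IsBezout.gcd_dvd_right a c
    generalize IsBezout.gcd a c = d at *
    have hd : d ≠ 0 := by
      rintro rfl
      exact h ⟨by simpa using ha, by simpa using hc⟩
    refine ⟨d, a', c', x, y, ha, hc, mul_left_cancel₀ hd ?_⟩
    rw [← sub_eq_zero]
    linear_combination hxy - x * ha - y * hc

theorem K_of_cond {R : Type*} [CommRing R] [IsDomain R] [IsBezout R]
    (H : ∀ x y z t : R, IsCoprime x y → IsCoprime z t →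
        ∃ lam r s : R, x + lam * y = r * s ∧ IsCoprime r z ∧ IsCoprime s t ∧ IsCoprime r s) :
    K R := by
  rintro a b c ⟨f, g, h, e⟩
  obtain ⟨d, a', c', x, y, rfl, rfl, hxy⟩ := gcd2 a c
  obtain ⟨lam, r, s, h1, h2, h3, h4⟩ := H g d a' c'
    ⟨b, a' * f + c' * h, by linear_combination e⟩ ⟨x, y, by linear_combination hxy⟩
  have hac : IsCoprime a' c' := ⟨x, y, by linear_combination hxy⟩
  -- `s a'` and `c' r` are coprime
  have hco : IsCoprime (s * a') (c' * r) := by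
    apply IsCoprime.mul_left <;> apply IsCoprime.mul_right
    · exact h3
    · exact h4.symm
    · exact hac
    · exact h2.symm
  obtain ⟨m, n, hmn⟩ := hco
  -- `1 - s b r = d * w`
  let w := a' * f + c' * h - b * lam
  have hw : 1 - s * b * r = d * w := by
    simp only [w]; linear_combination b * h1 - e
  refine ⟨s, n * w, m * w, r, ?_⟩
  linear_combination d * w * hmn - hw

theorem cond_of_K {R : Type*} [CommRing R] (H : K R) (x y z t : R)
    (hxy : IsCoprime x y) (hzt : IsCoprime z t) :
    ∃ lam r s : R, x + lam * y = r * s ∧ IsCoprime r z ∧ IsCoprime s t ∧ IsCoprime r s := by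
  obtain ⟨b, e, hb⟩ := hxy
  obtain ⟨k, l, hkl⟩ := hzt
  obtain ⟨p, q, u, v, h⟩ := H (y * z) b (y * t)
    ⟨e * k, x, e * l, by linear_combination hb + y * e * hkl⟩
  refine ⟨p * v * e - x * (p * z * u + q * t * v), v, p, ?_, ?_, ?_, ?_⟩
  · linear_combination p * v * hb - x * h
  · exact ⟨p * b + q * (y * t), p * y * u, by linear_combination h⟩
  · exact ⟨y * z * u + b * v, q * y * v, by linear_combination h⟩
  · exact ⟨q * (y * t), y * z * u + b * v, by linear_combination h⟩

theorem K_of_edr {R : Type*} [CommRing R] (H : IsElementaryDivisorRing R) : K R := by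
  rintro a b c ⟨f, g, h, e⟩
  obtain ⟨P, Q, hP, hQ, h0, h1⟩ := H 2 2 !![a, 0; b, c]
  have e01 := h0 0 1 (by simp)
  have e10 := h0 1 0 (by simp)
  have e11 := h1 0 1 0 1 rfl rfl rfl
  have e00 : (P * !![a, 0; b, c] * Q) 0 0 =
      Q 0 0 * a * P 0 0 + Q 0 0 * b * P 0 1 + Q 1 0 * c * P 0 1 := by
    simp [Matrix.mul_apply, Fin.sum_univ_two]; ring
  set D := P * !![a, 0; b, c] * Q with hD
  have hall : ∀ i j, D 0 0 ∣ D i j := by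
    intro i j
    fin_cases i <;> fin_cases j <;> simp_all
  obtain ⟨P', hP'⟩ := hP.exists_left_inv
  obtain ⟨Q', hQ'⟩ := hQ.exists_right_inv
  have hA : !![a, 0; b, c] = P' * D * Q' := by
    rw [hD]
    calc _ = (P' * P) * !![a, 0; b, c] * (Q * Q') := by rw [hP', hQ']; simp
      _ = _ := by simp only [Matrix.mul_assoc]
  have hall' : ∀ i j, D 0 0 ∣ !![a, 0; b, c] i j := by
    intro i j
    rw [hA]
    simp only [Matrix.mul_apply]
    exact Finset.dvd_sum fun k _ => Dvd.dvd.mul_right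
      (Finset.dvd_sum fun l _ => Dvd.dvd.mul_left (hall _ _) _) _
  have ha : D 0 0 ∣ a := by simpa using hall' 0 0
  have hb : D 0 0 ∣ b := by simpa using hall' 1 0
  have hc : D 0 0 ∣ c := by simpa using hall' 1 1
  have h1 : D 0 0 ∣ 1 := by
    rw [← e]
    exact dvd_add (dvd_add (ha.mul_right _) (hb.mul_right _)) (hc.mul_right _)
  obtain ⟨k, hk⟩ := h1
  refine ⟨Q 0 0, Q 1 0, P 0 0 * k, P 0 1 * k, ?_⟩
  rw [e00] at hk
  linear_combination -hk

theorem K_dvd {R : Type*} [CommRing R] [IsDomain R] [IsBezout R] (H : K R) (a b c : R) :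
    ∃ p q u v : R, p * a * u + p * b * v + q * c * v ∣ a ∧
      p * a * u + p * b * v + q * c * v ∣ b ∧ p * a * u + p * b * v + q * c * v ∣ c := by
  obtain ⟨e, b', c', x', y', rfl, rfl, hxy'⟩ := gcd2 b c
  obtain ⟨d, a', e', x, y, rfl, rfl, hxy⟩ := gcd2 a e
  obtain ⟨p, q, u, v, h⟩ := H a' (e' * b') (e' * c')
    ⟨x, x' * y, y' * y, by linear_combination hxy + e' * y * hxy'⟩
  have hd : p * (d * a') * u + p * (d * e' * b') * v + q * (d * e' * c') * v = d := by
    linear_combination d * h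
  refine ⟨p, q, u, v, ?_⟩
  rw [hd]
  exact ⟨⟨a', rfl⟩, ⟨e' * b', by ring⟩, ⟨e' * c', by ring⟩⟩

theorem bil2 {R : Type*} [CommRing R] [IsDomain R] [IsBezout R] (H : K R) (α β γ δ : R) :
    ∃ s t p q : R, s * p * α + s * q * β + t * p * γ + t * q * δ ∣ α ∧
      s * p * α + s * q * β + t * p * γ + t * q * δ ∣ δ := by
  obtain ⟨g, α', β', x, y, rfl, rfl, hxy⟩ := gcd2 α β
  obtain ⟨p, q, u, v, ha, hb, hc⟩ := K_dvd H g (x * γ + y * δ) (-β' * γ + α' * δ)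
  refine ⟨u, v, p * x - q * β', p * y + q * α', ?_⟩
  have : u * (p * x - q * β') * (g * α') + u * (p * y + q * α') * (g * β') +
      v * (p * x - q * β') * γ + v * (p * y + q * α') * δ =
      p * g * u + p * (x * γ + y * δ) * v + q * (-β' * γ + α' * δ) * v := by
    linear_combination u * p * g * hxy
  rw [this]
  refine ⟨ha.mul_right _, ?_⟩
  have : δ = β' * (x * γ + y * δ) + x * (-β' * γ + α' * δ) := by
    linear_combination (-δ) * hxy
  obtain ⟨k1, h1⟩ := hb
  obtain ⟨k2, h2⟩ := hc
  exact ⟨β' * k1 + x * k2, by linear_combination this + β' * h1 + x * h2⟩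

theorem exists_vecs {R : Type*} [CommRing R] [IsDomain R] [IsBezout R] (H : K R) {n m : ℕ}
    (A : Matrix (Fin n) (Fin m) R) :
    ∃ (u : Fin n → R) (w : Fin m → R), ∀ i j, u ⬝ᵥ A *ᵥ w ∣ A i j := by
  suffices h : ∀ S : Finset (Fin n × Fin m), ∃ (u : Fin n → R) (w : Fin m → R),
      ∀ x ∈ S, u ⬝ᵥ A *ᵥ w ∣ A x.1 x.2 by
    obtain ⟨u, w, h⟩ := h Finset.univ
    exact ⟨u, w, fun i j => h (i, j) (Finset.mem_univ _)⟩
  intro S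
  induction S using Finset.induction_on with
  | empty => exact ⟨0, 0, by simp⟩
  | insert x S _ ih =>
    obtain ⟨u, w, ih⟩ := ih
    let u' : Fin n → R := Pi.single x.1 1
    let w' : Fin m → R := Pi.single x.2 1
    have hx : u' ⬝ᵥ A *ᵥ w' = A x.1 x.2 := by simp [u', w']
    obtain ⟨s, t, p, q, h1, h2⟩ := bil2 H (u ⬝ᵥ A *ᵥ w) (u ⬝ᵥ A *ᵥ w') (u' ⬝ᵥ A *ᵥ w)
      (u' ⬝ᵥ A *ᵥ w')
    have e : (s • u + t • u') ⬝ᵥ A *ᵥ (p • w + q • w') =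
        s * p * (u ⬝ᵥ A *ᵥ w) + s * q * (u ⬝ᵥ A *ᵥ w') + t * p * (u' ⬝ᵥ A *ᵥ w) +
          t * q * (u' ⬝ᵥ A *ᵥ w') := by
      simp only [mulVec_add, mulVec_smul, add_dotProduct, dotProduct_add, smul_dotProduct,
        dotProduct_smul, smul_eq_mul]
      ring
    refine ⟨s • u + t • u', p • w + q • w', ?_⟩
    rw [e]
    intro y hy
    rcases Finset.mem_insert.1 hy with rfl | hy
    · rw [← hx]; exact h2
    · exact h1.trans (ih y hy)

/-- two-coordinate operation -/
theorem step_equiv {R : Type*} [CommRing R] {n : ℕ} (i : Fin (n + 1)) (hi : i ≠ 0)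
    (a b x y : R) (h : a * x + b * y = 1) :
    ∃ e : (Fin (n + 1) → R) ≃ₗ[R] (Fin (n + 1) → R),
      ∀ v k, e v k = if k = 0 then x * v 0 + y * v i else
        if k = i then -b * v 0 + a * v i else v k := by
  refine ⟨{ toFun := fun v k => if k = 0 then x * v 0 + y * v i else
              if k = i then -b * v 0 + a * v i else v k
            invFun := fun v k => if k = 0 then a * v 0 - y * v i else
              if k = i then b * v 0 + x * v i else v k
            map_add' := ?_, map_smul' := ?_, left_inv := ?_, right_inv := ?_ }, fun v k => rfl⟩
  · intro v w; ext k; simp only [Pi.add_apply]; split_ifs <;> ring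
  · intro v w; ext k; simp only [Pi.smul_apply, smul_eq_mul, RingHom.id_apply]; split_ifs <;> ring
  · intro v; ext k
    by_cases h0 : k = 0
    · subst h0; simp only [if_true, hi, if_false]; linear_combination v 0 * h
    · by_cases h1 : k = i
      · subst h1; simp only [if_true, hi, if_false]; linear_combination v k * h
      · simp only [h0, h1, if_false]
  · intro v; ext k
    by_cases h0 : k = 0
    · subst h0; simp only [if_true, hi, if_false]; linear_combination v 0 * h
    · by_cases h1 : k = i
      · subst h1; simp only [if_true, hi, if_false]; linear_combination v k * h
      · simp only [h0, h1, if_false]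

theorem complete {R : Type*} [CommRing R] [IsDomain R] [IsBezout R] {n : ℕ}
    (u : Fin (n + 1) → R) :
    ∃ (N : Matrix (Fin (n + 1)) (Fin (n + 1)) R) (g : R), IsUnit N ∧
      u = g • (N *ᵥ Pi.single 0 1) := by
  have h : ∀ S : Finset (Fin (n + 1)), 0 ∉ S →
      ∃ e : (Fin (n + 1) → R) ≃ₗ[R] (Fin (n + 1) → R), ∀ k ∈ S, e u k = 0 := by
    intro S
    induction S using Finset.induction_on with
    | empty => exact fun _ => ⟨LinearEquiv.refl _ _, by simp⟩
    | insert i S hiS ih =>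
      intro h0
      have hi : i ≠ 0 := by rintro rfl; simp at h0
      have h0S : 0 ∉ S := fun h => h0 (Finset.mem_insert_of_mem h)
      obtain ⟨e, he⟩ := ih h0S
      obtain ⟨d, a, b, x, y, h1, h2, h3⟩ := gcd2 (e u 0) (e u i)
      obtain ⟨f, hf⟩ := step_equiv i hi a b x y h3
      refine ⟨e.trans f, fun k hk => ?_⟩
      have hk0 : k ≠ 0 := by rintro rfl; exact h0 hk
      rw [LinearEquiv.trans_apply, hf, if_neg hk0]
      split_ifs with hki
      · rw [h1, h2]; ring
      · exact he k ((Finset.mem_insert.1 hk).resolve_left hki)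
  obtain ⟨e, he⟩ := h (Finset.univ.erase 0) (by simp)
  refine ⟨LinearMap.toMatrix' (e.symm : (Fin (n + 1) → R) →ₗ[R] (Fin (n + 1) → R)), e u 0, ?_, ?_⟩
  · apply IsUnit.of_mul_eq_one (LinearMap.toMatrix' (e : (Fin (n + 1) → R) →ₗ[R] (Fin (n + 1) → R)))
    rw [← LinearMap.toMatrix'_comp]
    simp
  · rw [LinearMap.toMatrix'_mulVec, ← map_smul]
    have : e u 0 • (Pi.single 0 1 : Fin (n + 1) → R) = e u := by
      ext k
      by_cases hk : k = 0
      · subst hk; simp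
      · simp [hk, he k (by simp [hk])]
    rw [this]; simp

theorem exists_corner {R : Type*} [CommRing R] [IsDomain R] [IsBezout R] (H : K R) {n m : ℕ}
    (A : Matrix (Fin (n + 1)) (Fin (m + 1)) R) :
    ∃ (P : Matrix (Fin (n + 1)) (Fin (n + 1)) R) (Q : Matrix (Fin (m + 1)) (Fin (m + 1)) R),
      IsUnit P ∧ IsUnit Q ∧ ∀ i j, (P * A * Q) 0 0 ∣ (P * A * Q) i j := by
  obtain ⟨u, w, h⟩ := exists_vecs H A
  obtain ⟨N, g, hN, hu⟩ := complete u
  obtain ⟨M, g', hM, hw⟩ := complete w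
  refine ⟨Nᵀ, M, ?_, hM, ?_⟩
  · rw [Matrix.isUnit_iff_isUnit_det] at *
    simpa using hN
  have e : u ⬝ᵥ A *ᵥ w = g * g' * (Nᵀ * A * M) 0 0 := by
    have : (Nᵀ * A * M) 0 0 = (N *ᵥ Pi.single 0 1) ⬝ᵥ A *ᵥ (M *ᵥ Pi.single 0 1) := by
      rw [Matrix.mul_assoc]
      simp [dotProduct, mulVec, Matrix.mul_apply, Pi.single_apply]
    rw [hu, hw, this]
    simp only [mulVec_smul, smul_dotProduct, dotProduct_smul, smul_eq_mul]
    ring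
  have h' : ∀ i j, (Nᵀ * A * M) 0 0 ∣ A i j := fun i j =>
    (e ▸ Dvd.intro_left _ rfl : (Nᵀ * A * M) 0 0 ∣ u ⬝ᵥ A *ᵥ w).trans (h i j)
  intro i j
  generalize (Nᵀ * A * M) 0 0 = d at h' ⊢
  simp only [Matrix.mul_apply]
  exact Finset.dvd_sum fun k _ => Dvd.dvd.mul_right
      (Finset.dvd_sum fun l _ => Dvd.dvd.mul_left (h' _ _) _) _

/-- block diagonal matrix with corner `d`. -/
def blk {R : Type*} [CommRing R] {n m : ℕ} (d : R) (A : Matrix (Fin n) (Fin m) R) :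
    Matrix (Fin (n + 1)) (Fin (m + 1)) R :=
  Matrix.of (Fin.cons (Fin.cons d 0) (fun i => Fin.cons 0 (A i)))

section
variable {R : Type*} [CommRing R] {n m k : ℕ} (d e : R)
  (A : Matrix (Fin n) (Fin m) R) (B : Matrix (Fin m) (Fin k) R)

@[simp] theorem blk00 : blk d A 0 0 = d := rfl
@[simp] theorem blk0s (j : Fin m) : blk d A 0 j.succ = 0 := rfl
@[simp] theorem blks0 (i : Fin n) : blk d A i.succ 0 = 0 := rfl
@[simp] theorem blkss (i : Fin n) (j : Fin m) : blk d A i.succ j.succ = A i j := rfl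

theorem blk_mul : blk d A * blk e B = blk (d * e) (A * B) := by
  ext i j
  refine Fin.cases ?_ (fun i => ?_) i <;> refine Fin.cases ?_ (fun j => ?_) j <;>
    simp [Matrix.mul_apply, Fin.sum_univ_succ]

theorem blk_one : blk (1 : R) (1 : Matrix (Fin n) (Fin n) R) = 1 := by
  ext i j
  refine Fin.cases ?_ (fun i => ?_) i <;> refine Fin.cases ?_ (fun j => ?_) j <;>
    simp [Matrix.one_apply, (Fin.succ_ne_zero _).symm]

theorem blk_unit (P : Matrix (Fin n) (Fin n) R) (h : IsUnit P) : IsUnit (blk 1 P) := by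
  obtain ⟨Q, hQ⟩ := h.exists_right_inv
  apply IsUnit.of_mul_eq_one (blk 1 Q)
  rw [blk_mul, hQ, one_mul, blk_one]

theorem unip (c : Fin (n + 1) → R) (hc : c 0 = 0) :
    IsUnit (1 - vecMulVec c (Pi.single 0 1) : Matrix (Fin (n + 1)) (Fin (n + 1)) R) ∧
    IsUnit (1 - vecMulVec (Pi.single 0 1) c : Matrix (Fin (n + 1)) (Fin (n + 1)) R) := by
  constructor <;> apply IsNilpotent.isUnit_one_sub <;> refine ⟨2, ?_⟩ <;>
    rw [pow_two, vecMulVec_mul_vecMulVec] <;> simp [hc]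

end

theorem exists_blk {R : Type*} [CommRing R] [IsDomain R] [IsBezout R] (H : K R) {n m : ℕ}
    (A : Matrix (Fin (n + 1)) (Fin (m + 1)) R) :
    ∃ (P : Matrix (Fin (n + 1)) (Fin (n + 1)) R) (Q : Matrix (Fin (m + 1)) (Fin (m + 1)) R)
      (d : R) (A' : Matrix (Fin n) (Fin m) R),
      IsUnit P ∧ IsUnit Q ∧ P * A * Q = blk d (d • A') := by
  obtain ⟨P, Q, hP, hQ, h⟩ := exists_corner H A
  generalize hB : P * A * Q = B at h
  choose c hc using h
  let l : Fin (n + 1) → R := fun i => if i = 0 then 0 else c i 0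
  let r : Fin (m + 1) → R := fun j => if j = 0 then 0 else c 0 j
  let L : Matrix (Fin (n + 1)) (Fin (n + 1)) R := 1 - vecMulVec l (Pi.single 0 1)
  let T : Matrix (Fin (m + 1)) (Fin (m + 1)) R := 1 - vecMulVec (Pi.single 0 1) r
  refine ⟨L * P, Q * T, B 0 0,
    Matrix.of fun i j => c i.succ j.succ - c i.succ 0 * c 0 j.succ,
    (unip l (by simp [l])).1.mul hP, hQ.mul (unip r (by simp [r])).2, ?_⟩
  have e : L * P * A * (Q * T) =
      L * B * T := by
    rw [← hB]; simp only [Matrix.mul_assoc]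
  have e1 : ∀ i j, (L * B) i j = B i j - l i * B 0 j := by
    intro i j
    simp only [L]
    rw [Matrix.sub_mul, Matrix.one_mul, Matrix.sub_apply, Matrix.mul_apply]
    simp [vecMulVec_apply, Pi.single_apply]
  have e2 : ∀ (C : Matrix (Fin (n + 1)) (Fin (m + 1)) R) i j,
      (C * T) i j = C i j - C i 0 * r j := by
    intro C i j
    simp only [T]
    rw [Matrix.mul_sub, Matrix.mul_one, Matrix.sub_apply, Matrix.mul_apply]
    simp [vecMulVec_apply, Pi.single_apply]
  rw [e]
  ext i j
  rw [e2, e1, e1]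
  refine Fin.cases ?_ (fun i => ?_) i <;> refine Fin.cases ?_ (fun j => ?_) j
  · simp [l, r]
  · have := hc 0 j.succ
    simp [l, r]
    linear_combination this
  · have := hc i.succ 0
    simp [l, r]
    linear_combination this
  · have h1 := hc i.succ j.succ
    have h2 := hc i.succ 0
    have h3 := hc 0 j.succ
    simp [l, r]
    linear_combination h1 - c i.succ 0 * h3 - c 0 j.succ * h2

theorem edr_of_K {R : Type*} [CommRing R] [IsDomain R] [IsBezout R] (H : K R) :
    IsElementaryDivisorRing R := by
  intro n
  induction n with
  | zero => exact fun m A => ⟨1, 1, isUnit_one, isUnit_one, fun i => i.elim0, fun i => i.elim0⟩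
  | succ n ih =>
    intro m A
    cases m with
    | zero => exact ⟨1, 1, isUnit_one, isUnit_one, fun _ j => j.elim0, fun _ _ j => j.elim0⟩
    | succ m =>
      obtain ⟨P, Q, d, A', hP, hQ, h⟩ := exists_blk H A
      obtain ⟨P', Q', hP', hQ', h0, h1⟩ := ih m A'
      have e : blk 1 P' * P * A * (Q * blk 1 Q') = blk d (d • (P' * A' * Q')) := by
        calc _ = blk 1 P' * (P * A * Q) * blk 1 Q' := by simp only [Matrix.mul_assoc]
          _ = _ := by rw [h, blk_mul, blk_mul]; simp
      refine ⟨blk 1 P' * P, Q * blk 1 Q', (blk_unit _ hP').mul hP, hQ.mul (blk_unit _ hQ'), ?_⟩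
      rw [e]
      constructor
      · intro i j
        refine Fin.cases ?_ (fun i => ?_) i <;> refine Fin.cases ?_ (fun j => ?_) j <;> intro hij
        · simp at hij
        · simp
        · simp
        · have := h0 i j (by simpa using hij)
          simp [this]
      · intro i i' j j'
        refine Fin.cases ?_ (fun i' => ?_) i'
        · intro _ _ h3; simp at h3
        refine Fin.cases ?_ (fun j' => ?_) j'
        · intro _ h3; simp at h3
        refine Fin.cases ?_ (fun i => ?_) i <;> refine Fin.cases ?_ (fun j => ?_) j
        · intro _ _ _; simp
        · intro h3; simp at h3
        · intro h3; simp at h3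
        · intro h3 h4 h5
          have := h1 i i' j j' (by simpa using h3) (by simpa using h4) (by simpa using h5)
          simp only [blkss, Matrix.smul_apply, smul_eq_mul]
          exact mul_dvd_mul_left _ this

end NeatEDR


theorem edr_iff_neat_condition (R : Type*) [CommRing R] [IsDomain R] [IsBezout R] :
    IsElementaryDivisorRing R ↔
      ∀ x y z t : R, Ideal.span {x} + Ideal.span {y} = ⊤ →
        Ideal.span {z} + Ideal.span {t} = ⊤ →
        ∃ lam r s : R, x + lam * y = r * s ∧
          Ideal.span {r} + Ideal.span {z} = ⊤ ∧
          Ideal.span {s} + Ideal.span {t} = ⊤ ∧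
          Ideal.span {r} + Ideal.span {s} = ⊤ := by
  simp only [NeatEDR.span_iff]
  exact ⟨fun h => NeatEDR.cond_of_K (NeatEDR.K_of_edr h),
    fun h => NeatEDR.edr_of_K (NeatEDR.K_of_cond h)⟩
end
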